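/- If (r₁, r₂, r₃) ∈ ℝ³_{>0} generates a degenerate triangle with flat vertex v₃ (i.e. l₁₂ = l₁₃ + l₂₃), then there exists ε > 0 such that for all t ∈ (0, ε) the triple (r₁, r₂, r₃ + t) is admissible and the partial derivative ∂h_{12,3}/∂r₃ evaluated at (r₁, r₂, r₃ + t) is positive. -/

import Mathlib

/-- Inversive distance edge length for radii `a, b` and weight `I` on the edge. -/
noncomputable def lenr (I a b : ℝ) : ℝ :=
  Real.sqrt (a ^ 2 + b ^ 2 + 2 * a * b * I)

/-- Length `l₁₂` of the triple `p = (r₁, r₂, r₃)`. -/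
noncomputable def l12 (I₃ : ℝ) (p : ℝ × ℝ × ℝ) : ℝ := lenr I₃ p.1 p.2.1

/-- Length `l₁₃` of the triple `p = (r₁, r₂, r₃)`. -/
noncomputable def l13 (I₂ : ℝ) (p : ℝ × ℝ × ℝ) : ℝ := lenr I₂ p.1 p.2.2

/-- Length `l₂₃` of the triple `p = (r₁, r₂, r₃)`. -/
noncomputable def l23 (I₁ : ℝ) (p : ℝ × ℝ × ℝ) : ℝ := lenr I₁ p.2.1 p.2.2

/-- Admissibility of the triple `p`. -/
def admissibleP (I₁ I₂ I₃ : ℝ) (p : ℝ × ℝ × ℝ) : Prop :=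
  l12 I₃ p < l13 I₂ p + l23 I₁ p ∧
  l13 I₂ p < l12 I₃ p + l23 I₁ p ∧
  l23 I₁ p < l12 I₃ p + l13 I₂ p

/-- Inner angle `θ₁` at the vertex `v₁`. -/
noncomputable def theta1' (I₁ I₂ I₃ : ℝ) (p : ℝ × ℝ × ℝ) : ℝ :=
  Real.arccos ((l12 I₃ p ^ 2 + l13 I₂ p ^ 2 - l23 I₁ p ^ 2) / (2 * l12 I₃ p * l13 I₂ p))

/-- `A = l₁₂ l₁₃ sin θ₁`. -/
noncomputable def areaA (I₁ I₂ I₃ : ℝ) (p : ℝ × ℝ × ℝ) : ℝ :=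
  l12 I₃ p * l13 I₂ p * Real.sin (theta1' I₁ I₂ I₃ p)

/-- `h₃ = κ₃(1 − I₃²) + κ₁γ₂ + κ₂γ₁`. -/
noncomputable def hfun3 (I₁ I₂ I₃ : ℝ) (p : ℝ × ℝ × ℝ) : ℝ :=
  (1 / p.2.2) * (1 - I₃ ^ 2) + (1 / p.1) * (I₂ + I₁ * I₃) + (1 / p.2.1) * (I₁ + I₂ * I₃)

/-- `h₁₂,₃ = r₁²r₂²r₃² κ₃ h₃ / (A l₁₂)`. -/
noncomputable def H123 (I₁ I₂ I₃ : ℝ) (p : ℝ × ℝ × ℝ) : ℝ :=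
  p.1 ^ 2 * p.2.1 ^ 2 * p.2.2 ^ 2 * ((1 / p.2.2) * hfun3 I₁ I₂ I₃ p) /
    (areaA I₁ I₂ I₃ p * l12 I₃ p)

open Filter Topology

theorem lenr_sq {I a b : ℝ} (hI : 1 < I) (ha : 0 < a) (hb : 0 < b) :
    lenr I a b ^ 2 = a ^ 2 + b ^ 2 + 2 * a * b * I :=
  Real.sq_sqrt (by have := zero_lt_one.trans hI; positivity)

theorem lenr_pos {I a b : ℝ} (hI : 1 < I) (ha : 0 < a) (hb : 0 < b) : 0 < lenr I a b :=
  Real.sqrt_pos.2 (by have := zero_lt_one.trans hI; positivity)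

theorem lenr_lt_lenr {I a b c : ℝ} (hI : 1 < I) (ha : 0 < a) (hb : 0 < b) (hbc : b < c) :
    lenr I a b < lenr I a c := by
  have hI₀ := zero_lt_one.trans hI
  unfold lenr
  refine Real.sqrt_lt_sqrt (by positivity) ?_
  gcongr

theorem continuous_lenr (I a : ℝ) : Continuous (lenr I a) := by
  unfold lenr
  fun_prop

/-- The numbers `c₀, c₁, c₂` such that, with `r₃ = s`, one has `A² = c₀ + 2 c₁ s + c₂ s²` and
`r₁² r₂² r₃² κ₃ h₃ = c₀ + c₁ s`: this is `c₀`. -/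
noncomputable def areaCoeff₀ (I₃ a b : ℝ) : ℝ := a ^ 2 * b ^ 2 * (1 - I₃ ^ 2)

/-- The linear coefficient `c₁` (see `areaCoeff₀`). -/
noncomputable def areaCoeff₁ (I₁ I₂ I₃ a b : ℝ) : ℝ :=
  a * b * (b * (I₂ + I₁ * I₃) + a * (I₁ + I₂ * I₃))

/-- The quadratic coefficient `c₂` (see `areaCoeff₀`). -/
noncomputable def areaCoeff₂ (I₁ I₂ I₃ a b : ℝ) : ℝ :=
  b ^ 2 * (1 - I₁ ^ 2) + a ^ 2 * (1 - I₂ ^ 2) + 2 * a * b * (I₃ + I₁ * I₂)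

/-- The polynomial in `r₃ = s` that equals `A²`. -/
noncomputable def areaSq (I₁ I₂ I₃ a b s : ℝ) : ℝ :=
  areaCoeff₀ I₃ a b + 2 * areaCoeff₁ I₁ I₂ I₃ a b * s + areaCoeff₂ I₁ I₂ I₃ a b * s ^ 2

section

variable {I₁ I₂ I₃ a b s : ℝ}

theorem areaCoeff_discr_pos (hI₁ : 1 < I₁) (hI₂ : 1 < I₂) (hI₃ : 1 < I₃) (ha : 0 < a)
    (hb : 0 < b) :
    0 < areaCoeff₁ I₁ I₂ I₃ a b ^ 2 - areaCoeff₀ I₃ a b * areaCoeff₂ I₁ I₂ I₃ a b := by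
  have h₁ : 0 < I₁ := by linarith
  have h₂ : 0 < I₂ := by linarith
  have h₃ : 0 < I₃ := by linarith
  have hJ₁ : 0 < I₁ ^ 2 - 1 := by nlinarith
  have hJ₃ : 0 < I₃ ^ 2 - 1 := by nlinarith
  have key : areaCoeff₁ I₁ I₂ I₃ a b ^ 2 - areaCoeff₀ I₃ a b * areaCoeff₂ I₁ I₂ I₃ a b =
      a ^ 2 * b ^ 2 * ((a ^ 2 + b ^ 2) * ((I₁ ^ 2 - 1) + I₂ ^ 2 + I₃ ^ 2 + 2 * I₁ * I₂ * I₃) +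
        2 * a * b * ((I₁ + I₂ * I₃) * (I₂ + I₁ * I₃) + (I₃ ^ 2 - 1) * (I₃ + I₁ * I₂))) := by
    unfold areaCoeff₁ areaCoeff₀ areaCoeff₂
    ring
  rw [key]
  positivity

theorem four_mul_areaSq (hI₁ : 1 < I₁) (hI₂ : 1 < I₂) (hI₃ : 1 < I₃) (ha : 0 < a) (hb : 0 < b)
    (hs : 0 < s) :
    4 * areaSq I₁ I₂ I₃ a b s = 4 * (lenr I₃ a b ^ 2 * lenr I₂ a s ^ 2) -
      (lenr I₃ a b ^ 2 + lenr I₂ a s ^ 2 - lenr I₁ b s ^ 2) ^ 2 := by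
  rw [lenr_sq hI₃ ha hb, lenr_sq hI₂ ha hs, lenr_sq hI₁ hb hs]
  unfold areaSq areaCoeff₁ areaCoeff₀ areaCoeff₂
  ring

theorem areaSq_pos (hI₁ : 1 < I₁) (hI₂ : 1 < I₂) (hI₃ : 1 < I₃) (ha : 0 < a) (hb : 0 < b)
    (hs : 0 < s) (hadm : admissibleP I₁ I₂ I₃ (a, b, s)) : 0 < areaSq I₁ I₂ I₃ a b s := by
  have h := four_mul_areaSq hI₁ hI₂ hI₃ ha hb hs
  obtain ⟨h₁, h₂, h₃⟩ := hadm
  simp only [l12, l13, l23] at h₁ h₂ h₃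
  have hL := lenr_pos hI₃ ha hb
  have hm := lenr_pos hI₂ ha hs
  have hn := lenr_pos hI₁ hb hs
  generalize lenr I₃ a b = L at *
  generalize lenr I₂ a s = m at *
  generalize lenr I₁ b s = n at *
  have hpos : 0 < (L + m + n) * (L + m - n) * ((L + n - m) * (m + n - L)) :=
    mul_pos (mul_pos (by positivity) (by linarith)) (mul_pos (by linarith) (by linarith))
  nlinarith

theorem areaA_eq_sqrt (hI₁ : 1 < I₁) (hI₂ : 1 < I₂) (hI₃ : 1 < I₃) (ha : 0 < a) (hb : 0 < b)
    (hs : 0 < s) : areaA I₁ I₂ I₃ (a, b, s) = √(areaSq I₁ I₂ I₃ a b s) := by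
  have h := four_mul_areaSq hI₁ hI₂ hI₃ ha hb hs
  have hL := lenr_pos hI₃ ha hb
  have hm := lenr_pos hI₂ ha hs
  simp only [areaA, theta1', l12, l13, l23, Real.sin_arccos]
  rw [← Real.sqrt_sq (mul_pos hL hm).le, ← Real.sqrt_mul (sq_nonneg _)]
  congr 1
  rw [eq_comm, ← mul_right_inj' (four_ne_zero (α := ℝ)), h]
  field_simp
  ring

theorem H123_eq (hI₁ : 1 < I₁) (hI₂ : 1 < I₂) (hI₃ : 1 < I₃) (ha : 0 < a) (hb : 0 < b)
    (hs : 0 < s) :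
    H123 I₁ I₂ I₃ (a, b, s) = (areaCoeff₀ I₃ a b + areaCoeff₁ I₁ I₂ I₃ a b * s) /
      (√(areaSq I₁ I₂ I₃ a b s) * lenr I₃ a b) := by
  simp only [H123, areaA_eq_sqrt hI₁ hI₂ hI₃ ha hb hs, l12]
  congr 1
  unfold hfun3 areaCoeff₁ areaCoeff₀
  field_simp
  ring

theorem hasDerivAt_div_sqrt_quadratic {c₀ c₁ c₂ L s : ℝ} (hL : L ≠ 0)
    (hQ : 0 < c₀ + 2 * c₁ * s + c₂ * s ^ 2) :
    HasDerivAt (fun x => (c₀ + c₁ * x) / (√(c₀ + 2 * c₁ * x + c₂ * x ^ 2) * L))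
      (s * (c₁ ^ 2 - c₀ * c₂) / (√(c₀ + 2 * c₁ * s + c₂ * s ^ 2) ^ 3 * L)) s := by
  have hN : HasDerivAt (fun x => c₀ + c₁ * x) c₁ s := by
    simpa using ((hasDerivAt_id s).const_mul c₁).const_add c₀
  have hP : HasDerivAt (fun x => c₀ + 2 * c₁ * x + c₂ * x ^ 2) (2 * c₁ + c₂ * (2 * s)) s := by
    simpa using (((hasDerivAt_id s).const_mul (2 * c₁)).const_add c₀).fun_add
      ((hasDerivAt_pow 2 s).const_mul c₂)
  have hR := Real.sqrt_pos.2 hQ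
  have hsq := Real.sq_sqrt hQ.le
  refine (hN.fun_div ((hP.sqrt hQ.ne').mul_const L) (mul_ne_zero hR.ne' hL)).congr_deriv ?_
  generalize √(c₀ + 2 * c₁ * s + c₂ * s ^ 2) = R at *
  field_simp
  rw [hsq]
  ring

theorem deriv_H123_pos (hI₁ : 1 < I₁) (hI₂ : 1 < I₂) (hI₃ : 1 < I₃) (ha : 0 < a) (hb : 0 < b)
    (hs : 0 < s) (hadm : admissibleP I₁ I₂ I₃ (a, b, s)) :
    0 < deriv (fun x => H123 I₁ I₂ I₃ (a, b, x)) s := by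
  have hQ := areaSq_pos hI₁ hI₂ hI₃ ha hb hs hadm
  have hL := lenr_pos hI₃ ha hb
  have hev : (fun x => H123 I₁ I₂ I₃ (a, b, x)) =ᶠ[𝓝 s] _ :=
    (eventually_gt_nhds hs).mono fun x hx => H123_eq hI₁ hI₂ hI₃ ha hb hx
  rw [((hasDerivAt_div_sqrt_quadratic hL.ne' hQ).congr_of_eventuallyEq hev).deriv]
  have hD := areaCoeff_discr_pos hI₁ hI₂ hI₃ ha hb
  have hR := Real.sqrt_pos.2 hQ
  exact div_pos (mul_pos hs hD) (mul_pos (pow_pos hR 3) hL)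

theorem eventually_admissibleP_of_flat (hI₁ : 1 < I₁) (hI₂ : 1 < I₂) (ha : 0 < a) (hb : 0 < b)
    (hs : 0 < s) (hflat : l12 I₃ (a, b, s) = l13 I₂ (a, b, s) + l23 I₁ (a, b, s)) :
    ∀ᶠ x in 𝓝[>] s, admissibleP I₁ I₂ I₃ (a, b, x) := by
  simp only [admissibleP, l12, l13, l23] at hflat ⊢
  have hm := lenr_pos hI₂ ha hs
  have hn := lenr_pos hI₁ hb hs
  have cm := (continuous_lenr I₂ a).continuousAt (x := s)
  have cn := (continuous_lenr I₁ b).continuousAt (x := s)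
  have e₂ : ∀ᶠ x in 𝓝 s, lenr I₂ a x < lenr I₃ a b + lenr I₁ b x :=
    cm.eventually_lt (continuousAt_const.add cn) (by linarith)
  have e₃ : ∀ᶠ x in 𝓝 s, lenr I₁ b x < lenr I₃ a b + lenr I₂ a x :=
    cn.eventually_lt (continuousAt_const.add cm) (by linarith)
  filter_upwards [self_mem_nhdsWithin, e₂.filter_mono nhdsWithin_le_nhds,
    e₃.filter_mono nhdsWithin_le_nhds] with x hx h₂ h₃
  exact ⟨hflat ▸ add_lt_add (lenr_lt_lenr hI₂ ha hs hx) (lenr_lt_lenr hI₁ hb hs hx), h₂, h₃⟩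

end

/-- Proposition 2.6(b): if `(r₁, r₂, r₃)` generates a degenerate triangle with
flat vertex `v₃`, then there is `ε > 0` so that for `t ∈ (0, ε)` the triple
`(r₁, r₂, r₃ + t)` is admissible and `∂h₁₂,₃/∂r₃ > 0` there. -/
theorem stmt_7 (I₁ I₂ I₃ r₁ r₂ r₃ : ℝ)
    (hI₁ : 1 < I₁) (hI₂ : 1 < I₂) (hI₃ : 1 < I₃)
    (hr₁ : 0 < r₁) (hr₂ : 0 < r₂) (hr₃ : 0 < r₃)
    (hdeg : l12 I₃ (r₁, r₂, r₃) = l13 I₂ (r₁, r₂, r₃) + l23 I₁ (r₁, r₂, r₃)) :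
    ∃ ε > 0, ∀ t ∈ Set.Ioo (0 : ℝ) ε,
      admissibleP I₁ I₂ I₃ (r₁, r₂, r₃ + t) ∧
      0 < deriv (fun s : ℝ => H123 I₁ I₂ I₃ (r₁, r₂, s)) (r₃ + t) := by
  obtain ⟨u, hu, hadm⟩ := mem_nhdsGT_iff_exists_Ioo_subset.1
    (eventually_admissibleP_of_flat hI₁ hI₂ hr₁ hr₂ hr₃ hdeg)
  refine ⟨u - r₃, sub_pos.2 hu, fun t ht => ?_⟩
  have h : admissibleP I₁ I₂ I₃ (r₁, r₂, r₃ + t) :=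
    hadm ⟨by linarith [ht.1], by linarith [ht.2]⟩
  exact ⟨h, deriv_H123_pos hI₁ hI₂ hI₃ hr₁ hr₂ (add_pos hr₃ ht.1) h⟩
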